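/- arXiv:1903.11491 — 2 statements merged into one kernel-verified Lean document; each statement's English description precedes it below -/
import Mathlib

section
/- Let c₁ > c₂ > 0 and d₁, d₂ ∈ ℝ. Set κ = (√c₁ + √c₂)/(√c₁ − √c₂), ξ₁ = √c₁·(x − c₁ t + d₁), ξ₂ = √c₂·(x − c₂ t + d₂), and define u(x,t) = 2√6·κ·(√c₁·cosh ξ₂ + √c₂·cosh ξ₁) / ( (κ² − 1) + κ²·cosh(ξ₁ − ξ₂) + cosh(ξ₁ + ξ₂) ). Then the denominator is strictly positive for all (x,t), u is a smooth function on ℝ², and u satisfies the mKdV equation ∂_t u + u²·∂_x u + ∂_x³ u = 0 everywhere (the two-soliton solution). -/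
/-- Partial derivative with respect to the first (space) variable. -/
noncomputable def pdx (f : ℝ × ℝ → ℝ) : ℝ × ℝ → ℝ := fun p => deriv (fun y => f (y, p.2)) p.1

/-- Partial derivative with respect to the second (time) variable. -/
noncomputable def pdt (f : ℝ × ℝ → ℝ) : ℝ × ℝ → ℝ := fun p => deriv (fun s => f (p.1, s)) p.2

/-- `ξ = √c (x - c t + d)`. -/
noncomputable def xi (c d : ℝ) : ℝ × ℝ → ℝ := fun p => Real.sqrt c * (p.1 - c * p.2 + d)

/-- `κ = (√c₁ + √c₂)/(√c₁ − √c₂)`. -/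
noncomputable def kap (c₁ c₂ : ℝ) : ℝ :=
  (Real.sqrt c₁ + Real.sqrt c₂) / (Real.sqrt c₁ - Real.sqrt c₂)

/-- Denominator of the two-soliton solution. -/
noncomputable def twoSolDen (c₁ c₂ d₁ d₂ : ℝ) : ℝ × ℝ → ℝ := fun p =>
  ((kap c₁ c₂) ^ 2 - 1) + (kap c₁ c₂) ^ 2 * Real.cosh (xi c₁ d₁ p - xi c₂ d₂ p)
    + Real.cosh (xi c₁ d₁ p + xi c₂ d₂ p)

/-- The two-soliton solution of the mKdV equation. -/
noncomputable def twoSol (c₁ c₂ d₁ d₂ : ℝ) : ℝ × ℝ → ℝ := fun p =>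
  2 * Real.sqrt 6 * kap c₁ c₂
      * (Real.sqrt c₁ * Real.cosh (xi c₂ d₂ p) + Real.sqrt c₂ * Real.cosh (xi c₁ d₁ p))
    / twoSolDen c₁ c₂ d₁ d₂ p

/-- `df` is the partial derivative of `f` with respect to the first variable. -/
def HasPdx (f df : ℝ × ℝ → ℝ) : Prop :=
  ∀ p, HasDerivAt (fun y => f (y, p.2)) (df p) p.1

/-- `df` is the partial derivative of `f` with respect to the second variable. -/
def HasPdt (f df : ℝ × ℝ → ℝ) : Prop :=
  ∀ p, HasDerivAt (fun s => f (p.1, s)) (df p) p.2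

theorem HasPdx.pdx_eq {f df : ℝ × ℝ → ℝ} (h : HasPdx f df) : pdx f = df :=
  funext fun p => (h p).deriv

theorem HasPdt.pdt_eq {f df : ℝ × ℝ → ℝ} (h : HasPdt f df) : pdt f = df :=
  funext fun p => (h p).deriv

/-- If `f` and `g` satisfy Hirota's bilinear equations for mKdV, then
`m ∂ₓ arctan (g / f) = m (gₓ f - g fₓ) / (f² + g²)` with `m² = 24` solves mKdV. -/
theorem mkdv_of_bilinear {f g fx gx fxx gxx fxxx gxxx ft gt fxt gxt : ℝ × ℝ → ℝ} {m : ℝ}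
    (hm : m ^ 2 = 24) (hS : ∀ p, f p ^ 2 + g p ^ 2 ≠ 0)
    (hf : HasPdx f fx) (hfx : HasPdx fx fxx) (hfxx : HasPdx fxx fxxx)
    (hg : HasPdx g gx) (hgx : HasPdx gx gxx) (hgxx : HasPdx gxx gxxx)
    (hft : HasPdt f ft) (hgt : HasPdt g gt) (hfxt : HasPdt fx fxt) (hgxt : HasPdt gx gxt)
    (hftx : HasPdx ft fxt) (hgtx : HasPdx gt gxt)
    (hB : ∀ p, f p * fxx p + g p * gxx p = fx p ^ 2 + gx p ^ 2)
    (hT : ∀ p, gt p * f p - g p * ft p + gxxx p * f p - 3 * (gxx p * fx p)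
      + 3 * (gx p * fxx p) - g p * fxxx p = 0)
    {u : ℝ × ℝ → ℝ}
    (hu : ∀ p, u p = m * ((gx p * f p - g p * fx p) / (f p ^ 2 + g p ^ 2))) (p : ℝ × ℝ) :
    pdt u p + u p ^ 2 * pdx u p + pdx (pdx (pdx u)) p = 0 := by
  obtain rfl : u = fun p => m * ((gx p * f p - g p * fx p) / (f p ^ 2 + g p ^ 2)) := funext hu
  set S : ℝ × ℝ → ℝ := fun p => f p ^ 2 + g p ^ 2 with hSdef
  set Sx : ℝ × ℝ → ℝ := fun p => 2 * (f p * fx p + g p * gx p) with hSxdef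
  set w : ℝ × ℝ → ℝ := fun p => (gx p * f p - g p * fx p) / S p with hwdef
  set wx : ℝ × ℝ → ℝ := fun p => (gxx p * f p - g p * fxx p - w p * Sx p) / S p with hwxdef
  set T : ℝ × ℝ → ℝ := fun p => (gt p * f p - g p * ft p) / S p with hTdef
  set wt : ℝ × ℝ → ℝ := fun p => (gxt p * f p + gx p * ft p - gt p * fx p - g p * fxt p
    - w p * (2 * (f p * ft p + g p * gt p))) / S p with hwtdef
  have dS : HasPdx S Sx := fun p =>
    (((hf p).fun_pow 2).fun_add ((hg p).fun_pow 2)).congr_deriv (by simp [hSxdef]; ring)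
  have dSx : HasPdx Sx fun p => 4 * (fx p ^ 2 + gx p ^ 2) := fun p =>
    ((((hf p).fun_mul (hfx p)).fun_add ((hg p).fun_mul (hgx p))).const_mul 2).congr_deriv
      (by linear_combination 2 * hB p)
  have dSt : HasPdt S fun p => 2 * (f p * ft p + g p * gt p) := fun p =>
    (((hft p).fun_pow 2).fun_add ((hgt p).fun_pow 2)).congr_deriv (by simp; ring)
  have dw : HasPdx w wx := fun p =>
    ((((hgx p).fun_mul (hf p)).fun_sub ((hg p).fun_mul (hfx p))).fun_div (dS p)
      (hS p)).congr_deriv (by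
        have := hS p
        change S p ≠ 0 at this
        simp only [hwxdef, hwdef]
        field_simp
        ring)
  have dwt : HasPdt w wt := fun p =>
    ((((hgxt p).fun_mul (hft p)).fun_sub ((hgt p).fun_mul (hfxt p))).fun_div (dSt p)
      (hS p)).congr_deriv (by
        have := hS p
        change S p ≠ 0 at this
        simp only [hwtdef, hwdef]
        field_simp
        ring)
  have dwx : HasPdx wx fun p => -T p - 8 * w p ^ 3 := fun p =>
    ((((((hgxx p).fun_mul (hf p)).fun_sub ((hg p).fun_mul (hfxx p))).fun_sub
      ((dw p).fun_mul (dSx p))).fun_div (dS p) (hS p))).congr_deriv (by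
        have := hS p
        simp only [hwxdef, hwdef, hTdef, hSdef, hSxdef]
        field_simp
        linear_combination (-4 * (gx p * f p - g p * fx p) * (f p ^ 2 + g p ^ 2)) * hB p
          + (f p ^ 2 + g p ^ 2) ^ 2 * hT p)
  have dT : HasPdx T wt := fun p =>
    ((((hgtx p).fun_mul (hf p)).fun_sub ((hg p).fun_mul (hftx p))).fun_div (dS p)
      (hS p)).congr_deriv (by
        have := hS p
        simp only [hwtdef, hwdef, hSdef, hSxdef]
        field_simp
        ring)
  have dwxx : HasPdx (fun p => -T p - 8 * w p ^ 3) fun p => -wt p - 24 * w p ^ 2 * wx p :=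
    fun p => ((dT p).fun_neg.fun_sub (((dw p).fun_pow 3).const_mul 8)).congr_deriv
      (by simp; ring)
  have du : HasPdx (fun p => m * w p) fun p => m * wx p := fun p => (dw p).const_mul m
  have dux : HasPdx (fun p => m * wx p) fun p => m * (-T p - 8 * w p ^ 3) :=
    fun p => (dwx p).const_mul m
  have duxx : HasPdx (fun p => m * (-T p - 8 * w p ^ 3))
      fun p => m * (-wt p - 24 * w p ^ 2 * wx p) := fun p => (dwxx p).const_mul m
  have dut : HasPdt (fun p => m * w p) fun p => m * wt p := fun p => (dwt p).const_mul m
  change pdt (fun p => m * w p) p + (m * w p) ^ 2 * pdx (fun p => m * w p) p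
    + pdx (pdx (pdx fun p => m * w p)) p = 0
  rw [du.pdx_eq, dux.pdx_eq, duxx.pdx_eq, dut.pdt_eq]
  linear_combination m * w p ^ 2 * wx p * hm

theorem hasPdx_exp_xi (c d : ℝ) :
    HasPdx (fun p => Real.exp (xi c d p)) fun p => √c * Real.exp (xi c d p) := fun p =>
  ((((hasDerivAt_id p.1).sub_const (c * p.2)).add_const d).const_mul √c).exp.congr_deriv
    (by simp [xi]; ring)

theorem hasPdt_exp_xi {c : ℝ} (hc : 0 ≤ c) (d : ℝ) :
    HasPdt (fun p => Real.exp (xi c d p)) fun p => -√c ^ 3 * Real.exp (xi c d p) := fun p =>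
  (((((hasDerivAt_id p.2).const_mul c).const_sub p.1).add_const d).const_mul
    √c).exp.congr_deriv (by
      simp only [xi, id]
      linear_combination (-√c * Real.exp (√c * (p.1 - c * p.2 + d))) * (Real.sq_sqrt hc).symm)

theorem sqrt_sub_sqrt_pos {c₁ c₂ : ℝ} (hc₂ : 0 < c₂) (hc : c₂ < c₁) : 0 < √c₁ - √c₂ :=
  sub_pos.2 (Real.sqrt_lt_sqrt hc₂.le hc)

theorem one_lt_kap {c₁ c₂ : ℝ} (hc₂ : 0 < c₂) (hc : c₂ < c₁) : 1 < kap c₁ c₂ := by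
  rw [kap, one_lt_div (sqrt_sub_sqrt_pos hc₂ hc)]
  linarith [Real.sqrt_pos.2 hc₂]

theorem twoSolDen_pos {c₁ c₂ : ℝ} (d₁ d₂ : ℝ) (hc₂ : 0 < c₂) (hc : c₂ < c₁) (p : ℝ × ℝ) :
    0 < twoSolDen c₁ c₂ d₁ d₂ p := by
  have hk : 0 < kap c₁ c₂ ^ 2 - 1 := by nlinarith [one_lt_kap hc₂ hc]
  unfold twoSolDen
  positivity

theorem contDiff_twoSol {c₁ c₂ : ℝ} (d₁ d₂ : ℝ) (hc₂ : 0 < c₂) (hc : c₂ < c₁) :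
    ContDiff ℝ (⊤ : ℕ∞) (twoSol c₁ c₂ d₁ d₂) := by
  have hx (c d : ℝ) : ContDiff ℝ (⊤ : ℕ∞) (xi c d) := by
    unfold xi
    fun_prop
  have h₁ := hx c₁ d₁
  have h₂ := hx c₂ d₂
  have hD : ContDiff ℝ (⊤ : ℕ∞) (twoSolDen c₁ c₂ d₁ d₂) := by
    unfold twoSolDen
    fun_prop
  unfold twoSol
  exact ContDiff.div (by fun_prop) hD fun p => (twoSolDen_pos d₁ d₂ hc₂ hc p).ne'

/-- The sum of squares of the tau functions `1 - e^(ξ₁ + ξ₂)` and `κ (e^ξ₁ + e^ξ₂)`. -/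
theorem tau_sq_add_sq (c₁ c₂ d₁ d₂ : ℝ) (p : ℝ × ℝ) :
    (1 - Real.exp (xi c₁ d₁ p) * Real.exp (xi c₂ d₂ p)) ^ 2
      + (kap c₁ c₂ * (Real.exp (xi c₁ d₁ p) + Real.exp (xi c₂ d₂ p))) ^ 2
      = 2 * (Real.exp (xi c₁ d₁ p) * Real.exp (xi c₂ d₂ p)) * twoSolDen c₁ c₂ d₁ d₂ p := by
  simp only [twoSolDen, Real.cosh_eq, Real.exp_neg, Real.exp_add, Real.exp_sub]
  field_simp
  ring

/-- The two-soliton in terms of the tau functions. -/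
theorem twoSol_eq_tau {c₁ c₂ : ℝ} (d₁ d₂ : ℝ) (hc₂ : 0 < c₂) (hc : c₂ < c₁) (p : ℝ × ℝ) :
    twoSol c₁ c₂ d₁ d₂ p = 2 * √6 *
      ((kap c₁ c₂ * (√c₁ * Real.exp (xi c₁ d₁ p) + √c₂ * Real.exp (xi c₂ d₂ p))
          * (1 - Real.exp (xi c₁ d₁ p) * Real.exp (xi c₂ d₂ p))
        - kap c₁ c₂ * (Real.exp (xi c₁ d₁ p) + Real.exp (xi c₂ d₂ p))
          * (-(√c₁ + √c₂) * (Real.exp (xi c₁ d₁ p) * Real.exp (xi c₂ d₂ p))))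
      / ((1 - Real.exp (xi c₁ d₁ p) * Real.exp (xi c₂ d₂ p)) ^ 2
        + (kap c₁ c₂ * (Real.exp (xi c₁ d₁ p) + Real.exp (xi c₂ d₂ p))) ^ 2)) := by
  have hD := (twoSolDen_pos d₁ d₂ hc₂ hc p).ne'
  rw [tau_sq_add_sq, twoSol, Real.cosh_eq, Real.cosh_eq, Real.exp_neg, Real.exp_neg]
  field_simp
  ring

/-- The two-soliton formula gives a globally defined smooth solution of mKdV. -/
theorem twoSol_solves_mkdv (c₁ c₂ d₁ d₂ : ℝ) (hc₂ : 0 < c₂) (hc : c₂ < c₁) :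
    (∀ p : ℝ × ℝ, 0 < twoSolDen c₁ c₂ d₁ d₂ p) ∧
    ContDiff ℝ (⊤ : ℕ∞) (twoSol c₁ c₂ d₁ d₂) ∧
    (∀ p : ℝ × ℝ,
      pdt (twoSol c₁ c₂ d₁ d₂) p
        + (twoSol c₁ c₂ d₁ d₂ p) ^ 2 * pdx (twoSol c₁ c₂ d₁ d₂) p
        + pdx (pdx (pdx (twoSol c₁ c₂ d₁ d₂))) p = 0) := by
  refine ⟨twoSolDen_pos d₁ d₂ hc₂ hc, contDiff_twoSol d₁ d₂ hc₂ hc, ?_⟩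
  have hk : kap c₁ c₂ * (√c₁ - √c₂) = √c₁ + √c₂ :=
    div_mul_cancel₀ _ (sqrt_sub_sqrt_pos hc₂ hc).ne'
  have ax := hasPdx_exp_xi c₁ d₁
  have bx := hasPdx_exp_xi c₂ d₂
  have a_t := hasPdt_exp_xi (hc₂.trans hc).le d₁
  have bt := hasPdt_exp_xi hc₂.le d₂
  have hS := tau_sq_add_sq c₁ c₂ d₁ d₂
  have hu := twoSol_eq_tau d₁ d₂ hc₂ hc
  have hS0 (p : ℝ × ℝ) :
      2 * (Real.exp (xi c₁ d₁ p) * Real.exp (xi c₂ d₂ p)) * twoSolDen c₁ c₂ d₁ d₂ p ≠ 0 := by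
    have := twoSolDen_pos d₁ d₂ hc₂ hc p
    positivity
  simp only [← hS] at hS0
  clear hS
  generalize kap c₁ c₂ = κ at *
  generalize √c₁ = k at *
  generalize √c₂ = l at *
  set a : ℝ × ℝ → ℝ := fun p => Real.exp (xi c₁ d₁ p)
  set b : ℝ × ℝ → ℝ := fun p => Real.exp (xi c₂ d₂ p)
  have abx (r : ℝ) : HasPdx (fun p => r * (a p * b p)) fun p => (k + l) * r * (a p * b p) :=
    fun p => (((ax p).fun_mul (bx p)).const_mul r).congr_deriv (by ring)
  have abt (r : ℝ) :
      HasPdt (fun p => r * (a p * b p)) fun p => -(k ^ 3 + l ^ 3) * r * (a p * b p) :=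
    fun p => (((a_t p).fun_mul (bt p)).const_mul r).congr_deriv (by ring)
  have sx (r s : ℝ) : HasPdx (fun p => κ * (r * a p + s * b p))
      fun p => κ * (k * r * a p + l * s * b p) :=
    fun p => ((((ax p).const_mul r).fun_add ((bx p).const_mul s)).const_mul κ).congr_deriv
      (by ring)
  have st (r s : ℝ) : HasPdt (fun p => κ * (r * a p + s * b p))
      fun p => κ * (-k ^ 3 * r * a p + -l ^ 3 * s * b p) :=
    fun p => ((((a_t p).const_mul r).fun_add ((bt p).const_mul s)).const_mul κ).congr_deriv
      (by ring)
  refine mkdv_of_bilinear (m := 2 * √6)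
    (f := fun p => 1 - a p * b p) (g := fun p => κ * (a p + b p))
    (fx := fun p => -(k + l) * (a p * b p)) (gx := fun p => κ * (k * a p + l * b p))
    (ft := fun p => (k ^ 3 + l ^ 3) * (a p * b p))
    (gt := fun p => κ * (-k ^ 3 * a p + -l ^ 3 * b p))
    ?_ hS0 ?_ (abx _) (abx _) ?_ (sx _ _) (sx _ _) ?_ ?_ (abt _) (st _ _) ?_ ?_ ?_ ?_ hu
  · rw [mul_pow, Real.sq_sqrt (by norm_num)]
    norm_num
  · exact fun p => (((ax p).fun_mul (bx p)).const_sub 1).congr_deriv (by ring)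
  · exact fun p => (((ax p).fun_add (bx p)).const_mul κ)
  · exact fun p => (((a_t p).fun_mul (bt p)).const_sub 1).congr_deriv (by ring)
  · exact fun p => (((a_t p).fun_add (bt p)).const_mul κ)
  · exact fun p => (abx _ p).congr_deriv (by ring)
  · exact fun p => (sx _ _ p).congr_deriv (by ring)
  · intro p
    linear_combination a p * b p * (κ * (k - l) + (k + l)) * hk
  · intro p
    ring
end

section
/- Fix Δx > 0, Δt > 0 and λ ∈ ℝ, and let u : ℤ × ℤ → ℝ be any grid function. Define F̃₁ = (1/3)·(μ_n μ_m² u_{-2,0})·μ_n((μ_m² u_{-2,0})²) + D_m²μ_n u_{-2,0} + λ·D_n D_m μ_m u_{-2,0} and G̃₁ = μ_m u_{-1,0}, the scheme residual Ã = D_m F̃₁ + D_n G̃₁ (the EC₈(λ) scheme for mKdV), the characteristic Q̃₃ = μ_m F̃₁, and F̃₃ = (1/2)·F̃₁² + (1/2)·[ (D_m μ_m μ_n u_{-2,0})·(D_n μ_m² u_{-2,0}) − (μ_m² μ_n u_{-2,0})·(D_m D_n μ_m u_{-2,0}) ] + (λ/2)·(D_n μ_m u_{-2,0})·(D_n μ_m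 u_{-1,0}) + (Δx²/48)·[ (μ_m² u_{-2,0})² + (μ_m² u_{-2,1})² + (μ_m² u_{-2,0})·(μ_m² u_{-2,1}) ]·[ (D_n μ_m² u_{-2,0})·(D_m μ_m μ_n u_{-2,0}) − (μ_m² μ_n u_{-2,0})·(D_m D_n μ_m u_{-2,0}) ], G̃₃ = (1/12)·(μ_m u_{-1,0})·(μ_m³ u_{-2,0})·[ μ_m²((μ_m u_{-2,0})²) + (Δx²/4)·(D_m μ_m u_{-2,0})·(D_m μ_m u_{-1,0}) ] + (1/2)·(μ_m u_{-1,0})·(D_m²μ_m u_{-2,0}). Then the identity Q̃₃·Ã = D_m F̃₃ + D_n G̃₃ holds at every point of ℤ × ℤ. In particular, every grid function satisfying the EC₈(λ) scheme Ã = 0 satisfies the discrete energy conservation law D_m F̃₃ + D_n G̃₃ = 0. -/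
noncomputable section

/-- Shift operator: `(Sh i j u)(m,n) = u(m+i, n+j)`. -/
def Sh (i j : ℤ) (f : ℤ × ℤ → ℝ) : ℤ × ℤ → ℝ := fun p => f (p.1 + i, p.2 + j)

/-- Forward difference in space: `D_m f = (S_m f − f)/Δx`. -/
def Dm (dx : ℝ) (f : ℤ × ℤ → ℝ) : ℤ × ℤ → ℝ := fun p => (f (p.1 + 1, p.2) - f p) / dx

/-- Forward difference in time: `D_n f = (S_n f − f)/Δt`. -/
def Dn (dt : ℝ) (f : ℤ × ℤ → ℝ) : ℤ × ℤ → ℝ := fun p => (f (p.1, p.2 + 1) - f p) / dt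

/-- Forward average in space: `μ_m f = (S_m f + f)/2`. -/
def μm (f : ℤ × ℤ → ℝ) : ℤ × ℤ → ℝ := fun p => (f (p.1 + 1, p.2) + f p) / 2

/-- Forward average in time: `μ_n f = (S_n f + f)/2`. -/
def μn (f : ℤ × ℤ → ℝ) : ℤ × ℤ → ℝ := fun p => (f (p.1, p.2 + 1) + f p) / 2

/-- Discrete flux `F̃₁` of the EC₈(λ) scheme. -/
def F1EC8 (dx dt lam : ℝ) (u : ℤ × ℤ → ℝ) : ℤ × ℤ → ℝ :=
  (1/3 : ℝ) • (μn (μm (μm (Sh (-2) 0 u))) * μn ((μm (μm (Sh (-2) 0 u))) ^ 2))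
    + Dm dx (Dm dx (μn (Sh (-2) 0 u)))
    + lam • Dn dt (Dm dx (μm (Sh (-2) 0 u)))

/-- Discrete mass density `G̃₁ = μ_m u_{-1,0}` of the EC₈(λ) scheme. -/
def G1EC8 (u : ℤ × ℤ → ℝ) : ℤ × ℤ → ℝ := μm (Sh (-1) 0 u)

/-- Residual of the EC₈(λ) scheme: `Ã = D_m F̃₁ + D_n G̃₁`. -/
def resEC8 (dx dt lam : ℝ) (u : ℤ × ℤ → ℝ) : ℤ × ℤ → ℝ :=
  Dm dx (F1EC8 dx dt lam u) + Dn dt (G1EC8 u)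

/-- Discrete characteristic `Q̃₃ = μ_m F̃₁`. -/
noncomputable def Q3EC8 (dx dt lam : ℝ) (u : ℤ × ℤ → ℝ) : ℤ × ℤ → ℝ :=
  μm (F1EC8 dx dt lam u)

/-- Discrete energy flux `F̃₃` of the EC₈(λ) scheme. -/
def F3EC8 (dx dt lam : ℝ) (u : ℤ × ℤ → ℝ) : ℤ × ℤ → ℝ :=
  (1/2 : ℝ) • (F1EC8 dx dt lam u) ^ 2
    + (1/2 : ℝ) • (Dm dx (μm (μn (Sh (-2) 0 u))) * Dn dt (μm (μm (Sh (-2) 0 u)))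
        - μm (μm (μn (Sh (-2) 0 u))) * Dm dx (Dn dt (μm (Sh (-2) 0 u))))
    + (lam / 2) • (Dn dt (μm (Sh (-2) 0 u)) * Dn dt (μm (Sh (-1) 0 u)))
    + (dx ^ 2 / 48) •
        (((μm (μm (Sh (-2) 0 u))) ^ 2 + (μm (μm (Sh (-2) 1 u))) ^ 2
            + μm (μm (Sh (-2) 0 u)) * μm (μm (Sh (-2) 1 u)))
          * (Dn dt (μm (μm (Sh (-2) 0 u))) * Dm dx (μm (μn (Sh (-2) 0 u)))
              - μm (μm (μn (Sh (-2) 0 u))) * Dm dx (Dn dt (μm (Sh (-2) 0 u)))))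

/-- Discrete energy density `G̃₃` of the EC₈(λ) scheme. -/
def G3EC8 (dx : ℝ) (u : ℤ × ℤ → ℝ) : ℤ × ℤ → ℝ :=
  (1/12 : ℝ) • (μm (Sh (-1) 0 u) * μm (μm (μm (Sh (-2) 0 u)))
      * (μm (μm ((μm (Sh (-2) 0 u)) ^ 2))
          + (dx ^ 2 / 4) • (Dm dx (μm (Sh (-2) 0 u)) * Dm dx (μm (Sh (-1) 0 u)))))
    + (1/2 : ℝ) • (μm (Sh (-1) 0 u) * Dm dx (Dm dx (μm (Sh (-2) 0 u))))

/-- The contribution of the cubic nonlinearity to the energy identity. -/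
lemma cubic_part_mul_Dn (dx dt : ℝ) (hdx : dx ≠ 0) (hdt : dt ≠ 0) (u : ℤ × ℤ → ℝ) (p : ℤ × ℤ) :
    (1/3 : ℝ) * μm (μn (μm (μm (Sh (-2) 0 u))) * μn ((μm (μm (Sh (-2) 0 u))) ^ 2)) p
        * Dn dt (μm (Sh (-1) 0 u)) p
      = (dx ^ 2 / 48) * Dm dx (((μm (μm (Sh (-2) 0 u))) ^ 2 + (μm (μm (Sh (-2) 1 u))) ^ 2
            + μm (μm (Sh (-2) 0 u)) * μm (μm (Sh (-2) 1 u)))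
          * (Dn dt (μm (μm (Sh (-2) 0 u))) * Dm dx (μm (μn (Sh (-2) 0 u)))
              - μm (μm (μn (Sh (-2) 0 u))) * Dm dx (Dn dt (μm (Sh (-2) 0 u))))) p
        + (1/12 : ℝ) * Dn dt (μm (Sh (-1) 0 u) * μm (μm (μm (Sh (-2) 0 u)))
      * (μm (μm ((μm (Sh (-2) 0 u)) ^ 2))
          + (dx ^ 2 / 4) • (Dm dx (μm (Sh (-2) 0 u)) * Dm dx (μm (Sh (-1) 0 u))))) p := by
  obtain ⟨m, n⟩ := p
  have h₁ : m + 1 + -2 = m - 1 := by ring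
  have h₂ : m + 1 + 1 + -2 = m := by ring
  have h₃ : m + 1 + 1 + 1 + -2 = m + 1 := by ring
  have h₄ : m + 1 + -1 = m := by ring
  have h₅ : m + 1 + 1 + -1 = m + 1 := by ring
  have h₆ : m + -2 = m - 2 := by ring
  have h₇ : m + -1 = m - 1 := by ring
  simp only [Dm, Dn, μm, μn, Sh, Pi.add_apply, Pi.sub_apply, Pi.mul_apply, Pi.pow_apply,
    Pi.smul_apply, smul_eq_mul, add_zero, h₁, h₂, h₃, h₄, h₅, h₆, h₇]
  generalize u (m - 2, n) = a₀, u (m - 1, n) = a₁, u (m, n) = a₂, u (m + 1, n) = a₃,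
    u (m - 2, n + 1) = b₀, u (m - 1, n + 1) = b₁, u (m, n + 1) = b₂, u (m + 1, n + 1) = b₃
  field_simp
  ring

/-- The contribution of the dispersive term to the energy identity. -/
lemma dispersive_part_mul_Dn (dx dt : ℝ) (hdx : dx ≠ 0) (hdt : dt ≠ 0) (u : ℤ × ℤ → ℝ)
    (p : ℤ × ℤ) :
    μm (Dm dx (Dm dx (μn (Sh (-2) 0 u)))) p * Dn dt (μm (Sh (-1) 0 u)) p
      = (1/2 : ℝ) * Dm dx (Dm dx (μm (μn (Sh (-2) 0 u))) * Dn dt (μm (μm (Sh (-2) 0 u)))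
        - μm (μm (μn (Sh (-2) 0 u))) * Dm dx (Dn dt (μm (Sh (-2) 0 u)))) p
        + (1/2 : ℝ) * Dn dt (μm (Sh (-1) 0 u) * Dm dx (Dm dx (μm (Sh (-2) 0 u)))) p := by
  obtain ⟨m, n⟩ := p
  have h₁ : m + 1 + -2 = m - 1 := by ring
  have h₂ : m + 1 + 1 + -2 = m := by ring
  have h₃ : m + 1 + 1 + 1 + -2 = m + 1 := by ring
  have h₄ : m + 1 + -1 = m := by ring
  have h₆ : m + -2 = m - 2 := by ring
  have h₇ : m + -1 = m - 1 := by ring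
  simp only [Dm, Dn, μm, μn, Sh, Pi.sub_apply, Pi.mul_apply, add_zero,
    h₁, h₂, h₃, h₄, h₆, h₇]
  generalize u (m - 2, n) = a₀, u (m - 1, n) = a₁, u (m, n) = a₂, u (m + 1, n) = a₃,
    u (m - 2, n + 1) = b₀, u (m - 1, n + 1) = b₁, u (m, n + 1) = b₂, u (m + 1, n + 1) = b₃
  field_simp
  ring

/-- The contribution of the mixed term, weighted by `λ` in the scheme, to the energy identity. -/
lemma mixed_part_mul_Dn (dx dt : ℝ) (hdx : dx ≠ 0) (hdt : dt ≠ 0) (u : ℤ × ℤ → ℝ) (p : ℤ × ℤ) :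
    μm (Dn dt (Dm dx (μm (Sh (-2) 0 u)))) p * Dn dt (μm (Sh (-1) 0 u)) p
      = (1/2 : ℝ) * Dm dx (Dn dt (μm (Sh (-2) 0 u)) * Dn dt (μm (Sh (-1) 0 u))) p := by
  obtain ⟨m, n⟩ := p
  have h₁ : m + 1 + -2 = m - 1 := by ring
  have h₂ : m + 1 + 1 + -2 = m := by ring
  have h₃ : m + 1 + 1 + 1 + -2 = m + 1 := by ring
  have h₄ : m + 1 + -1 = m := by ring
  have h₅ : m + 1 + 1 + -1 = m + 1 := by ring
  have h₆ : m + -2 = m - 2 := by ring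
  have h₇ : m + -1 = m - 1 := by ring
  simp only [Dm, Dn, μm, Sh, Pi.mul_apply, add_zero, h₁, h₂, h₃, h₄, h₅, h₆, h₇]
  generalize u (m - 2, n) = a₀, u (m - 1, n) = a₁, u (m, n) = a₂, u (m + 1, n) = a₃,
    u (m - 2, n + 1) = b₀, u (m - 1, n + 1) = b₁, u (m, n + 1) = b₂, u (m + 1, n + 1) = b₃
  field_simp
  ring

/-- A splitting of `μ_m F · D_n G` into discrete divergences, for the three components of a flux
`F`, assembles into a conservation law with characteristic `μ_m F`. -/
lemma μm_mul_residual_eq_divergence {dx dt a b c d e k lam : ℝ}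
    {A B C G A' B' C' G₁ G₂ : ℤ × ℤ → ℝ} {p : ℤ × ℤ}
    (hA : a * μm A p * Dn dt G p = d * Dm dx A' p + e * Dn dt G₁ p)
    (hB : μm B p * Dn dt G p = b * Dm dx B' p + k * Dn dt G₂ p)
    (hC : μm C p * Dn dt G p = c * Dm dx C' p) :
    μm (a • A + B + lam • C) p * (Dm dx (a • A + B + lam • C) + Dn dt G) p
      = (Dm dx ((1/2 : ℝ) • (a • A + B + lam • C) ^ 2 + b • B' + (lam * c) • C' + d • A')
          + Dn dt (e • G₁ + k • G₂)) p := by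
  simp only [μm, Dm, Dn, Pi.add_apply, Pi.pow_apply, Pi.smul_apply, smul_eq_mul] at *
  linear_combination hA + hB + lam * hC

/-- The energy identity at each grid point: the characteristic times the residual of the scheme is
the discrete divergence of the energy flux and the energy density. -/
lemma Q3EC8_mul_resEC8 (dx dt lam : ℝ) (hdx : dx ≠ 0) (hdt : dt ≠ 0) (u : ℤ × ℤ → ℝ) (p : ℤ × ℤ) :
    Q3EC8 dx dt lam u p * resEC8 dx dt lam u p
      = (Dm dx (F3EC8 dx dt lam u) + Dn dt (G3EC8 dx u)) p := by
  have h := μm_mul_residual_eq_divergence (lam := lam) (cubic_part_mul_Dn dx dt hdx hdt u p)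
    (dispersive_part_mul_Dn dx dt hdx hdt u p) (mixed_part_mul_Dn dx dt hdx hdt u p)
  rw [mul_one_div] at h
  exact h

/-- The EC₈(λ) scheme preserves a discrete energy conservation law. -/
theorem EC8_energy_conservation_law (dx dt lam : ℝ) (hdx : 0 < dx) (hdt : 0 < dt)
    (u : ℤ × ℤ → ℝ) :
    (∀ p : ℤ × ℤ,
      Q3EC8 dx dt lam u p * resEC8 dx dt lam u p
        = (Dm dx (F3EC8 dx dt lam u) + Dn dt (G3EC8 dx u)) p) ∧
    ((∀ p : ℤ × ℤ, resEC8 dx dt lam u p = 0) →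
      ∀ p : ℤ × ℤ, (Dm dx (F3EC8 dx dt lam u) + Dn dt (G3EC8 dx u)) p = 0) := by
  have key := Q3EC8_mul_resEC8 dx dt lam hdx.ne' hdt.ne' u
  refine ⟨key, fun h p => ?_⟩
  rw [← key p, h p, mul_zero]
end
end
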